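/- Let A be a (ρ, σ)-bounded injection pattern with ρ ≤ 1 on the single-destination path of size n, and let L be a load configuration realized at some round of an execution of the OED protocol on A. If I is a plateau of even height h in L, then L_h(I) = Σ_{i ∈ I} (L(i) − h) ≤ |I| + σ. -/

import Mathlib

/-- Injection patterns on the single-destination path of size `n` inject only into
buffers `1, …, n`. -/
def pathSupp (n : ℕ) (a : ℕ → ℕ → ℕ) : Prop :=
  ∀ t i, i ∉ Finset.Icc 1 n → a t i = 0

/-- The injection pattern `a` on the single-destination path of size `n` is locally
`(ρ, σ, β)`-bounded. -/
def LBPath (n : ℕ) (a : ℕ → ℕ → ℕ) (ρ σ : ℝ) (β : ℕ → ℝ) : Prop :=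
  ∀ s t : ℕ, ∀ S ⊆ Finset.Icc 1 n, ∀ e ∈ Finset.Icc 1 n,
    ((∑ r ∈ Finset.Icc s t, ∑ i ∈ S.filter (fun i => i ≤ e), a r i : ℕ) : ℝ)
      ≤ ρ * (Finset.Icc s t).card + σ + ∑ i ∈ S, β i

/-- The injection pattern `a` on the single-destination path of size `n` is
`(ρ, σ)`-bounded. -/
def BPath (n : ℕ) (a : ℕ → ℕ → ℕ) (ρ σ : ℝ) : Prop :=
  ∀ s t : ℕ, ∀ e ∈ Finset.Icc 1 n,
    ((∑ r ∈ Finset.Icc s t, ∑ i ∈ (Finset.Icc 1 n).filter (fun i => i ≤ e), a r i : ℕ) : ℝ)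
      ≤ ρ * (Finset.Icc s t).card + σ

/-- The Odd-Even Downhill forwarding decision for buffer `i` given the load
configuration `L` (with the convention `L (n+1) = 0`): buffer `i ∈ {1, …, n}` forwards
iff `L i > L (i+1)`, or `L i = L (i+1)` and `L i` is odd. -/
def oedF (n : ℕ) (L : ℕ → ℕ) (i : ℕ) : ℕ :=
  if 1 ≤ i ∧ i ≤ n ∧
      ((if i + 1 ≤ n then L (i + 1) else 0) < L i ∨
        (L i = (if i + 1 ≤ n then L (i + 1) else 0) ∧ Odd (L i)))
  then 1 else 0

/-- The loads of the OED protocol running on the injection pattern `a`: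
`oedL n a t i` is the load of buffer `i` at round `t` after injections, with
`L(0, i) = 0` and `L(t+1, i) = L(t, i) − F(t, i) + F(t, i−1) + a(t+1, i)`. -/
def oedL (n : ℕ) (a : ℕ → ℕ → ℕ) : ℕ → ℕ → ℕ
  | 0 => fun _ => 0
  | t + 1 => fun i =>
      oedL n a t i - oedF n (oedL n a t) i + oedF n (oedL n a t) (i - 1) + a (t + 1) i

/-- `[p, q] ⊆ {1, …, n}` is a plateau of height `h` for the configuration `L`:
every buffer of `[p, q]` has load at least `h`, and `[p, q]` is maximal with this
property. -/
def IsPlateau (n : ℕ) (L : ℕ → ℕ) (h p q : ℕ) : Prop :=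
  1 ≤ p ∧ p ≤ q ∧ q ≤ n ∧ (∀ i ∈ Finset.Icc p q, h ≤ L i) ∧
    (p = 1 ∨ L (p - 1) < h) ∧ (q = n ∨ L (q + 1) < h)

section OddEvenDownhill

variable {n : ℕ} {L : ℕ → ℕ} {h i : ℕ}

theorem oedF_le_one (n : ℕ) (L : ℕ → ℕ) (i : ℕ) : oedF n L i ≤ 1 := by
  unfold oedF; split_ifs <;> simp

theorem oedF_zero (n : ℕ) (L : ℕ → ℕ) : oedF n L 0 = 0 := by
  simp [oedF]

theorem oedF_eq_one_of_lt (h1 : 1 ≤ i) (hn : i ≤ n) (hlt : i + 1 ≤ n → L (i + 1) < L i)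
    (hpos : 0 < L i) : oedF n L i = 1 := by
  unfold oedF
  rw [if_pos]
  refine ⟨h1, hn, Or.inl ?_⟩
  split_ifs with hi
  exacts [hlt hi, hpos]

theorem oedF_eq_one_of_odd (h1 : 1 ≤ i) (hn : i + 1 ≤ n) (heq : L i = L (i + 1))
    (hodd : Odd (L i)) : oedF n L i = 1 := by
  unfold oedF
  rw [if_pos]
  exact ⟨h1, by omega, Or.inr ⟨by rw [if_pos hn, heq], hodd⟩⟩

theorem le_of_oedF_ne_zero (hF : oedF n L i ≠ 0) (hn : i + 1 ≤ n) :
    L (i + 1) < L i ∨ (L i = L (i + 1) ∧ Odd (L i)) := by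
  unfold oedF at hF
  rw [if_pos hn] at hF
  by_contra hc
  exact hF (if_neg fun hx => hc hx.2.2)

theorem oedF_le_load (n : ℕ) (L : ℕ → ℕ) (i : ℕ) : oedF n L i ≤ L i := by
  by_contra hc
  have hF := oedF_le_one n L i
  have h0 : L i = 0 := by omega
  have hz : oedF n L i = 0 := if_neg fun hx => by simp [h0] at hx
  omega

/-- The number of packets of height above `h` that buffer `i` forwards. -/
def oedExcessFlow (n : ℕ) (L : ℕ → ℕ) (h i : ℕ) : ℕ :=
  if h < L i then oedF n L i else 0

/-- One forwarding step creates no packets above an even height `h`: packets above `h` are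
either injected or received from packets above `h` at the previous buffer. -/
theorem excess_step_le (hh : Even h) (hn : i + 1 ≤ n) (b : ℕ) :
    (L (i + 1) - oedF n L (i + 1) + oedF n L i + b - h) + oedExcessFlow n L h (i + 1)
      ≤ (L (i + 1) - h) + oedExcessFlow n L h i + b := by
  have h1 := oedF_le_one n L i
  have h2 := oedF_le_one n L (i + 1)
  have h3 := oedF_le_load n L (i + 1)
  have h4 : oedF n L i ≠ 0 → _ := fun hF => le_of_oedF_ne_zero hF hn
  have h5 : L i = h → ¬ Odd (L i) := fun e => by rw [e]; exact Nat.not_odd_iff_even.2 hh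
  unfold oedExcessFlow
  split_ifs <;> grind

theorem sum_excess_step_le (hh : Even h) (b : ℕ → ℕ) (d : ℕ) {g : ℕ} (hdg : d + 1 ≤ g)
    (hg : g ≤ n + 1) :
    ∑ i ∈ Finset.Ico (d + 1) g, (L i - oedF n L i + oedF n L (i - 1) + b i - h)
        + oedExcessFlow n L h (g - 1)
      ≤ ∑ i ∈ Finset.Ico (d + 1) g, (L i - h) + oedExcessFlow n L h d
        + ∑ i ∈ Finset.Ico (d + 1) g, b i := by
  induction g, hdg using Nat.le_induction with
  | base => simp
  | succ g hdg ih =>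
    have ih := ih (by omega)
    obtain ⟨g, rfl⟩ : ∃ k, g = k + 1 := ⟨g - 1, by omega⟩
    have := excess_step_le (L := L) hh (show g + 1 ≤ n by omega) (b (g + 1))
    rw [Finset.sum_Ico_succ_top hdg, Finset.sum_Ico_succ_top hdg, Finset.sum_Ico_succ_top hdg]
    simp only [Nat.add_sub_cancel] at ih this ⊢
    omega

/-- If buffer `i + 1` has load at most the even height `h` after a step and buffer `i` was above
`h` before it, then buffer `i` forwards, and buffer `i + 1` was at load at most `h`. -/
theorem excess_forwarded (hh : Even h) (h1 : 1 ≤ i) (hn : i ≤ n) (b : ℕ) (hi : h < L i)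
    (hlow : i + 1 ≤ n → L (i + 1) - oedF n L (i + 1) + oedF n L i + b ≤ h) :
    oedF n L i = 1 ∧ (i + 1 ≤ n → L (i + 1) ≤ h) := by
  have hF : oedF n L i = 1 := by
    by_cases hin : i + 1 ≤ n
    · have := hlow hin
      have := oedF_le_one n L (i + 1)
      rcases lt_or_ge (L (i + 1)) (L i) with hlt | hge
      · exact oedF_eq_one_of_lt h1 hn (fun _ => hlt) (by omega)
      · have e : L i = h + 1 := by omega
        exact oedF_eq_one_of_odd h1 hin (by omega) (by rw [e]; exact hh.add_one)
    · exact oedF_eq_one_of_lt h1 hn (fun hc => absurd hc hin) (by omega)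
  refine ⟨hF, fun hin => ?_⟩
  have := hlow hin
  have := oedF_le_one n L (i + 1)
  omega

/-- A buffer that drops below an even height `h` was either already below `h`, or exactly at `h`
with its successor below `h`. -/
theorem lt_or_succ_lt_of_step_lt (hh : Even h) (b c : ℕ) (hn : i + 1 ≤ n)
    (hlow : L i - oedF n L i + c + b < h) :
    L i < h ∨ (L i = h ∧ L (i + 1) < h) := by
  have h1 := oedF_le_one n L i
  rcases lt_or_ge (L i) h with hlt | hge
  · exact Or.inl hlt
  · have e : L i = h := by omega
    rcases le_of_oedF_ne_zero (n := n) (L := L) (i := i) (by omega) hn with hl | ⟨-, ho⟩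
    · exact Or.inr ⟨e, by omega⟩
    · rw [e] at ho
      exact absurd hh (Nat.not_even_iff_odd.2 ho)

/-- The packets above an even height `h` strictly between a buffer `d` of load below `h` and a
buffer `g` of load at most `h` are accounted for by the injections of some final segment of
rounds, up to one packet per round and per buffer strictly between `d` and `g`. -/
theorem exists_excess_le_injections (a : ℕ → ℕ → ℕ) (hh : Even h) {e : ℕ} (he : e ≤ n) (t : ℕ) :
    ∀ d g : ℕ, g ≤ e + 1 → (d = 0 ∨ oedL n a t d < h) →
      (g = n + 1 ∨ oedL n a t g ≤ h) →
      ∃ s ≤ t, ∑ i ∈ Finset.Ico (d + 1) g, (oedL n a t i - h) + (t - s)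
        ≤ ∑ r ∈ Finset.Icc (s + 1) t, ∑ i ∈ (Finset.Icc 1 n).filter (fun i => i ≤ e), a r i
          + (g - d - 1) := by
  induction t with
  | zero => exact fun d g _ _ _ => ⟨0, le_rfl, by simp [oedL]⟩
  | succ t ih =>
    intro d g hge hd hg
    rcases le_or_gt g (d + 1) with hgd | hgd
    · exact ⟨t + 1, le_rfl, by simp [Finset.Ico_eq_empty_of_le hgd]⟩
    set L := oedL n a t with hL
    have hstep : ∀ i, oedL n a (t + 1) i
        = L i - oedF n L i + oedF n L (i - 1) + a (t + 1) i := fun _ => rfl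
    simp only [hstep] at hd hg ⊢
    have hsum := sum_excess_step_le (L := L) hh (a (t + 1)) d hgd.le
      (show g ≤ n + 1 by omega)
    have hinj : ∑ i ∈ Finset.Ico (d + 1) g, a (t + 1) i
        ≤ ∑ i ∈ (Finset.Icc 1 n).filter (fun i => i ≤ e), a (t + 1) i :=
      Finset.sum_le_sum_of_subset fun i hi => by
        simp only [Finset.mem_Ico, Finset.mem_filter, Finset.mem_Icc] at hi ⊢
        omega
    obtain ⟨k, rfl⟩ : ∃ k, g = k + 1 := ⟨g - 1, by omega⟩
    simp only [Nat.add_sub_cancel] at hsum hg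
    -- the left end stays, or moves one buffer to the right
    obtain ⟨d', hdd', hd', hflow, hsumd⟩ : ∃ d', d ≤ d' ∧ (d' = 0 ∨ L d' < h) ∧
        oedExcessFlow n L h d = 0 ∧ ∀ m, ∑ i ∈ Finset.Ico (d' + 1) m, (L i - h)
          = ∑ i ∈ Finset.Ico (d + 1) m, (L i - h) := by
      rcases hd with rfl | hd
      · exact ⟨0, le_rfl, Or.inl rfl, by simp [oedExcessFlow, oedF_zero], fun _ => rfl⟩
      rcases lt_or_succ_lt_of_step_lt hh _ _ (by omega) hd with hlt | ⟨heq, hlt⟩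
      · exact ⟨d, le_rfl, Or.inr hlt, if_neg (by omega), fun _ => rfl⟩
      · refine ⟨d + 1, by omega, Or.inr hlt, if_neg (by omega), fun m => ?_⟩
        rcases lt_or_ge (d + 1) m with hm | hm
        · rw [Finset.sum_eq_sum_Ico_succ_bot hm, Nat.sub_eq_zero_of_le hlt.le, zero_add]
        · rw [Finset.Ico_eq_empty_of_le hm, Finset.Ico_eq_empty_of_le (by omega)]
    -- the right end stays while losing a packet, or moves one buffer to the left
    obtain ⟨g', hg'k, hg', hcount⟩ : ∃ g', g' ≤ k + 1 ∧ (g' = n + 1 ∨ L g' ≤ h) ∧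
        ∑ i ∈ Finset.Ico (d + 1) (k + 1), (L i - h) + 1 + (g' - d' - 1)
          ≤ ∑ i ∈ Finset.Ico (d + 1) g', (L i - h) + oedExcessFlow n L h k
            + (k + 1 - d - 1) := by
      rcases lt_or_ge h (L k) with hk | hk
      · obtain ⟨hF, hk'⟩ := excess_forwarded (n := n) hh (by omega) (by omega) (a (t + 1) (k + 1))
          hk (fun hkn => hg.resolve_left (by omega))
        refine ⟨k + 1, le_rfl, ?_, ?_⟩
        · by_cases hkn : k + 1 ≤ n
          · exact Or.inr (hk' hkn)
          · exact Or.inl (by omega)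
        · rw [oedExcessFlow, if_pos hk, hF]
          omega
      · refine ⟨k, by omega, Or.inr hk, ?_⟩
        rw [Finset.sum_Ico_succ_top (by omega), Nat.sub_eq_zero_of_le hk]
        omega
    obtain ⟨s, hst, hs⟩ := ih d' g' (by omega) hd' hg'
    refine ⟨s, by omega, ?_⟩
    rw [hsumd] at hs
    rw [Finset.sum_Icc_succ_top (by omega)]
    omega

end OddEvenDownhill

/-- cf. Lemma 3.4 of Patt-Shamir–Rosenbaum: for a `(ρ, σ)`-bounded
injection pattern with `ρ ≤ 1`, in any configuration realized by OED forwarding, the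
number of packets above an even plateau `I` of height `h` is at most `|I| + σ`. -/
theorem stmt8 (n : ℕ) (a : ℕ → ℕ → ℕ) (ρ σ : ℝ) (hρ : ρ ≤ 1) (hσ : 0 ≤ σ)
    (hsupp : pathSupp n a) (hA : BPath n a ρ σ)
    (t h p q : ℕ) (hh : Even h) (hpl : IsPlateau n (oedL n a t) h p q) :
    ((∑ i ∈ Finset.Icc p q, (oedL n a t i - h) : ℕ) : ℝ)
      ≤ (Finset.Icc p q).card + σ := by
  obtain ⟨hp, hpq, hqn, -, hleft, hright⟩ := hpl
  obtain ⟨s, hst, hs⟩ := exists_excess_le_injections a hh hqn t (p - 1) (q + 1) le_rfl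
    (hleft.imp (by omega) id) (hright.imp (by omega) le_of_lt)
  have hIco : Finset.Ico (p - 1 + 1) (q + 1) = Finset.Icc p q := by
    ext i
    simp only [Finset.mem_Ico, Finset.mem_Icc]
    omega
  have hcard : q + 1 - (p - 1) - 1 = (Finset.Icc p q).card := by
    rw [Nat.card_Icc]
    omega
  rw [hIco, hcard] at hs
  have hinj := hA (s + 1) t q (Finset.mem_Icc.2 ⟨hp.trans hpq, hqn⟩)
  have hrounds : (Finset.Icc (s + 1) t).card = t - s := by
    rw [Nat.card_Icc]
    omega
  rw [hrounds] at hinj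
  have hρt : ρ * ((t - s : ℕ) : ℝ) ≤ 1 * ((t - s : ℕ) : ℝ) :=
    mul_le_mul_of_nonneg_right hρ (Nat.cast_nonneg _)
  have hs' := (Nat.cast_le (α := ℝ)).2 hs
  rw [Nat.cast_add, Nat.cast_add] at hs'
  linarith
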